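/- There exists a constant c ≥ 1 such that for all integers 0 ≤ n ≤ m one has (L²/#A)^{m−n}·𝓡_n ≤ c·𝓡_m, where L²/#A > 1. (Reverse doubling estimate for the resistance sequence; equation (3.14) of the paper in the planar case.) -/

import Mathlib

open Finset
open scoped Classical

namespace Carpet

/-- The contraction map `Ψ_{(a,b)}(x,y) = ((x+a)/L, (y+b)/L)`. -/
noncomputable def Psi (L : ℕ) (p : ℕ × ℕ) (x : ℝ × ℝ) : ℝ × ℝ :=
  ((x.1 + p.1) / L, (x.2 + p.2) / L)

/-- Words of length `n` over the alphabet `A`. -/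
abbrev Word (A : Finset (ℕ × ℕ)) (n : ℕ) := Fin n → {p : ℕ × ℕ // p ∈ A}

/-- `Ψ_w = Ψ_{w₁} ∘ ⋯ ∘ Ψ_{w_n}`. -/
noncomputable def PsiW (L : ℕ) {A : Finset (ℕ × ℕ)} {n : ℕ} (w : Word A n) : ℝ × ℝ → ℝ × ℝ :=
  (List.ofFn fun i => Psi L (w i).1).foldr (· ∘ ·) id

/-- The four corners of the unit square. -/
noncomputable def V0 : Finset (ℝ × ℝ) :=
  {((0 : ℝ), (0 : ℝ)), ((1 : ℝ), (0 : ℝ)), ((1 : ℝ), (1 : ℝ)), ((0 : ℝ), (1 : ℝ))}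

/-- The level-`n` vertex set `V_n = ⋃_{w ∈ W_n} Ψ_w(V₀)`. -/
noncomputable def VN (L : ℕ) (A : Finset (ℕ × ℕ)) (n : ℕ) : Finset (ℝ × ℝ) :=
  (Finset.univ : Finset (Word A n)).biUnion fun w => V0.image (PsiW L w)

/-- Euclidean distance in the plane. -/
noncomputable def eudist (x y : ℝ × ℝ) : ℝ :=
  Real.sqrt ((x.1 - y.1) ^ 2 + (x.2 - y.2) ^ 2)

/-- `n`-adjacency: `x = Ψ_w(p)`, `y = Ψ_w(q)` with `p, q ∈ V₀`, `|p - q| = 1`. -/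
def Adj (L : ℕ) (A : Finset (ℕ × ℕ)) (n : ℕ) (x y : ℝ × ℝ) : Prop :=
  ∃ w : Word A n, ∃ p ∈ V0, ∃ q ∈ V0,
    eudist p q = 1 ∧ x = PsiW L w p ∧ y = PsiW L w q

/-- The natural graph energy `D_n(f) = Σ_{x ∼ y} (f x - f y)²`
(summing over ordered pairs and halving). -/
noncomputable def Dform (L : ℕ) (A : Finset (ℕ × ℕ)) (n : ℕ) (f : ℝ × ℝ → ℝ) : ℝ :=
  (1 / 2) * ∑ x ∈ VN L A n, ∑ y ∈ VN L A n,
    (if Adj L A n x y then (f x - f y) ^ 2 else 0)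

/-- The effective resistance between `S` and `T` in the level-`n` graph. -/
noncomputable def EffRes (L : ℕ) (A : Finset (ℕ × ℕ)) (n : ℕ) (S T : Set (ℝ × ℝ)) : ℝ :=
  (sInf {e : ℝ | ∃ f : ℝ × ℝ → ℝ,
      (∀ x ∈ S, f x = 1) ∧ (∀ x ∈ T, f x = 0) ∧ e = Dform L A n f})⁻¹

/-- `𝓡_n`, the resistance between the corners `(0,0)` and `(1,0)`. -/
noncomputable def RR (L : ℕ) (A : Finset (ℕ × ℕ)) (n : ℕ) : ℝ :=
  EffRes L A n {((0 : ℝ), (0 : ℝ))} {((1 : ℝ), (0 : ℝ))}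

/-- `𝓡̄_n`, the resistance between the left and right sides of the unit square. -/
noncomputable def RRbar (L : ℕ) (A : Finset (ℕ × ℕ)) (n : ℕ) : ℝ :=
  EffRes L A n
    ((VN L A n : Set (ℝ × ℝ)) ∩ ({(0 : ℝ)} ×ˢ Set.Icc (0 : ℝ) 1))
    ((VN L A n : Set (ℝ × ℝ)) ∩ ({(1 : ℝ)} ×ˢ Set.Icc (0 : ℝ) 1))

/-- The standing assumptions on `(L, A)` defining a generalized Sierpiński carpet. -/
structure GoodCarpet (L : ℕ) (A : Finset (ℕ × ℕ)) : Prop where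
  three_le : 3 ≤ L
  mem_lt : ∀ p ∈ A, p.1 < L ∧ p.2 < L
  symm_swap : ∀ a b : ℕ, (a, b) ∈ A → (b, a) ∈ A
  symm_reflect : ∀ a b : ℕ, (a, b) ∈ A → (L - 1 - a, b) ∈ A
  connected : IsConnected
    (⋃ p ∈ A, Set.Icc (((p.1 : ℝ) / L, (p.2 : ℝ) / L) : ℝ × ℝ)
      ((((p.1 : ℝ) + 1) / L, ((p.2 : ℝ) + 1) / L) : ℝ × ℝ))
  flat_border : ∀ a b : ℕ, a < L → b < L →
    (a = 0 ∨ a = L - 1 ∨ b = 0 ∨ b = L - 1) → (a, b) ∈ A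
  proper : ∃ a b : ℕ, a < L ∧ b < L ∧ (a, b) ∉ A

/-- The generalized Sierpiński carpet `F`. -/
def carpetF (L : ℕ) (A : Finset (ℕ × ℕ)) : Set (ℝ × ℝ) :=
  ⋂ n : ℕ, ⋃ w : Word A n, PsiW L w '' Set.Icc (((0 : ℝ), (0 : ℝ)) : ℝ × ℝ) ((1 : ℝ), (1 : ℝ))


/-- The integer coordinates of the lower left corner of a cell, in units of `L ^ (-n)`. -/
def idx (L : ℕ) {A : Finset (ℕ × ℕ)} : (n : ℕ) → Word A n → ℕ × ℕ
  | 0, _ => (0, 0)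
  | n + 1, w => ((w 0).1.1 * L ^ n + (idx L n (Fin.tail w)).1,
      (w 0).1.2 * L ^ n + (idx L n (Fin.tail w)).2)

lemma PsiW_succ (L : ℕ) {A : Finset (ℕ × ℕ)} {n : ℕ} (w : Word A (n + 1)) (x : ℝ × ℝ) :
    PsiW L w x = Psi L (w 0).1 (PsiW L (Fin.tail w : Word A n) x) := by
  simp only [PsiW, List.ofFn_succ, List.foldr_cons, Function.comp]
  rfl

lemma PsiW_eq (L : ℕ) (hL : 3 ≤ L) {A : Finset (ℕ × ℕ)} {n : ℕ} (w : Word A n) (x : ℝ × ℝ) :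
    PsiW L w x = ((x.1 + (idx L n w).1) / (L : ℝ) ^ n, (x.2 + (idx L n w).2) / (L : ℝ) ^ n) := by
  have hL0 : (L : ℝ) ≠ 0 := by
    have : L ≠ 0 := by omega
    exact_mod_cast this
  induction n with
  | zero => simp [PsiW, idx]
  | succ n ih =>
    rw [PsiW_succ, ih]
    simp only [Psi, idx, Prod.mk.injEq]
    push_cast
    constructor <;> field_simp <;> ring

lemma idx_lt {L : ℕ} {A : Finset (ℕ × ℕ)} (h : GoodCarpet L A) {n : ℕ} (w : Word A n) :
    (idx L n w).1 < L ^ n ∧ (idx L n w).2 < L ^ n := by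
  induction n with
  | zero => simp [idx]
  | succ n ih =>
    obtain ⟨h1, h2⟩ := ih (Fin.tail w)
    obtain ⟨h3, h4⟩ := h.mem_lt _ (w 0).2
    simp only [idx, pow_succ']
    constructor <;> nlinarith

lemma digit_inj {N a b c d : ℕ} (hb : b < N) (hd : d < N) (e : a * N + b = c * N + d) :
    a = c ∧ b = d := by
  have hN : 0 < N := by omega
  have h1 : (a * N + b) / N = a := by
    rw [add_comm, Nat.add_mul_div_right _ _ hN, Nat.div_eq_of_lt hb]; simp
  have h2 : (c * N + d) / N = c := by
    rw [add_comm, Nat.add_mul_div_right _ _ hN, Nat.div_eq_of_lt hd]; simp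
  have : a = c := by rw [← h1, ← h2, e]
  subst this
  exact ⟨rfl, by omega⟩

lemma idx_inj {L : ℕ} {A : Finset (ℕ × ℕ)} (h : GoodCarpet L A) {n : ℕ} (w w' : Word A n)
    (e : idx L n w = idx L n w') : w = w' := by
  induction n with
  | zero => exact Subsingleton.elim _ _
  | succ n ih =>
    obtain ⟨h1, h2⟩ := idx_lt h (Fin.tail w : Word A n)
    obtain ⟨h3, h4⟩ := idx_lt h (Fin.tail w' : Word A n)
    simp only [idx, Prod.mk.injEq] at e
    obtain ⟨a1, a2⟩ := digit_inj h1 h3 e.1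
    obtain ⟨b1, b2⟩ := digit_inj h2 h4 e.2
    have ht := ih (Fin.tail w) (Fin.tail w') (Prod.ext a2 b2)
    have h0 : w 0 = w' 0 := Subtype.ext (Prod.ext a1 b1)
    rw [← Fin.cons_self_tail w, ← Fin.cons_self_tail w', h0, ht]

lemma PsiW_inj {L : ℕ} {A : Finset (ℕ × ℕ)} (h : GoodCarpet L A) {n : ℕ} (p : ℝ × ℝ)
    (w w' : Word A n) (e : PsiW L w p = PsiW L w' p) : w = w' := by
  have hL0 : (L : ℝ) ^ n ≠ 0 := by
    have : L ≠ 0 := by have := h.three_le; omega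
    exact pow_ne_zero _ (by exact_mod_cast this)
  rw [PsiW_eq L h.three_le, PsiW_eq L h.three_le, Prod.mk.injEq] at e
  obtain ⟨e1, e2⟩ := e
  rw [div_left_inj' hL0, add_right_inj] at e1 e2
  exact idx_inj h w w' (Prod.ext (by exact_mod_cast e1) (by exact_mod_cast e2))

lemma PsiW_append (L : ℕ) {A : Finset (ℕ × ℕ)} {n k : ℕ} (u : Word A n) (v : Word A k)
    (x : ℝ × ℝ) : PsiW L (Fin.append u v : Word A (n + k)) x = PsiW L u (PsiW L v x) := by
  have key : ∀ (l : List (ℝ × ℝ → ℝ × ℝ)) (g : ℝ × ℝ → ℝ × ℝ) (y : ℝ × ℝ),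
      l.foldr (· ∘ ·) g y = l.foldr (· ∘ ·) id (g y) := by
    intro l g y
    induction l with
    | nil => rfl
    | cons a l ih => simp [ih]
  have e : (fun i => Psi L ((Fin.append u v : Word A (n + k)) i).1)
      = Fin.append (fun i => Psi L (u i).1) (fun i => Psi L (v i).1) := by
    funext i
    refine Fin.addCases (fun i => ?_) (fun i => ?_) i <;> simp
  unfold PsiW
  rw [e, List.ofFn_fin_append, List.foldr_append, key]

lemma sum_cover {ι κ : Type*} (Z : Finset ι) (T : Finset κ) (φ : κ → ι)
    (hZ : ∀ z ∈ Z, ∃ t ∈ T, φ t = z) (F : ι → ℝ) (hF : ∀ z, 0 ≤ F z) :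
    ∑ z ∈ Z, F z ≤ ∑ t ∈ T, F (φ t) := by
  have hsub : Z ⊆ T.image φ := fun z hz => Finset.mem_image.2 (hZ z hz)
  calc ∑ z ∈ Z, F z ≤ ∑ z ∈ T.image φ, F z :=
        Finset.sum_le_sum_of_subset_of_nonneg hsub (fun _ _ _ => hF _)
    _ ≤ ∑ z ∈ T.image φ, ∑ t ∈ T with φ t = z, F (φ t) := by
        refine Finset.sum_le_sum fun z hz => ?_
        obtain ⟨t, ht, rfl⟩ := Finset.mem_image.1 hz
        exact Finset.single_le_sum (f := fun s => F (φ s)) (fun _ _ => hF _)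
          (Finset.mem_filter.2 ⟨ht, rfl⟩)
    _ = ∑ t ∈ T, F (φ t) :=
        Finset.sum_fiberwise_of_maps_to (fun t ht => Finset.mem_image_of_mem φ ht) _

lemma Dform_eq (L : ℕ) (A : Finset (ℕ × ℕ)) (n : ℕ) (f : ℝ × ℝ → ℝ) :
    Dform L A n f = (1 / 2) * ∑ z ∈ (VN L A n ×ˢ VN L A n).filter (fun z => Adj L A n z.1 z.2),
      (f z.1 - f z.2) ^ 2 := by
  rw [Dform, Finset.sum_filter, Finset.sum_product]

lemma mem_VN (L : ℕ) {A : Finset (ℕ × ℕ)} {n : ℕ} (w : Word A n) {p : ℝ × ℝ} (hp : p ∈ V0) :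
    PsiW L w p ∈ VN L A n :=
  Finset.mem_biUnion.2 ⟨w, Finset.mem_univ _, Finset.mem_image_of_mem _ hp⟩

lemma sum_le_Dform {L : ℕ} {A : Finset (ℕ × ℕ)} (h : GoodCarpet L A) (n : ℕ) (f : ℝ × ℝ → ℝ)
    {p q : ℝ × ℝ} (hp : p ∈ V0) (hq : q ∈ V0) (hpq : eudist p q = 1) :
    ∑ u : Word A n, (f (PsiW L u p) - f (PsiW L u q)) ^ 2 ≤ 2 * Dform L A n f := by
  rw [Dform_eq]
  have : ∑ u : Word A n, (f (PsiW L u p) - f (PsiW L u q)) ^ 2 =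
      ∑ z ∈ (Finset.univ : Finset (Word A n)).image (fun u => (PsiW L u p, PsiW L u q)),
        (f z.1 - f z.2) ^ 2 := by
    rw [Finset.sum_image]
    intro u _ v _ e
    exact PsiW_inj h p u v (congrArg Prod.fst e)
  rw [this, ← mul_assoc]
  norm_num only
  rw [one_mul]
  refine Finset.sum_le_sum_of_subset_of_nonneg ?_ (fun _ _ _ => sq_nonneg _)
  intro z hz
  obtain ⟨u, _, rfl⟩ := Finset.mem_image.1 hz
  exact Finset.mem_filter.2 ⟨Finset.mem_product.2 ⟨mem_VN L u hp, mem_VN L u hq⟩,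
    u, p, hp, q, hq, hpq, rfl, rfl⟩

lemma Dform_le (L : ℕ) (A : Finset (ℕ × ℕ)) (n : ℕ) (f : ℝ × ℝ → ℝ) :
    Dform L A n f ≤ (1 / 2) * ∑ w : Word A n,
      ∑ r ∈ (V0 ×ˢ V0).filter (fun r => eudist r.1 r.2 = 1),
        (f (PsiW L w r.1) - f (PsiW L w r.2)) ^ 2 := by
  rw [Dform_eq, ← Finset.sum_product']
  refine mul_le_mul_of_nonneg_left ?_ (by norm_num)
  refine sum_cover _ _ (fun t : Word A n × ((ℝ × ℝ) × (ℝ × ℝ)) =>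
    (PsiW L t.1 t.2.1, PsiW L t.1 t.2.2)) ?_ (fun z => (f z.1 - f z.2) ^ 2)
    (fun _ => sq_nonneg _)
  intro z hz
  obtain ⟨_, w, p, hp, q, hq, hpq, h1, h2⟩ := Finset.mem_filter.1 hz
  exact ⟨(w, (p, q)), Finset.mem_product.2 ⟨Finset.mem_univ _,
    Finset.mem_filter.2 ⟨Finset.mem_product.2 ⟨hp, hq⟩, hpq⟩⟩, Prod.ext h1.symm h2.symm⟩

/-- One-dimensional piecewise linear interpolation. -/
noncomputable def interp (g : ℤ → ℝ) (x : ℝ) : ℝ :=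
  g ⌊x⌋ * (1 - (x - ⌊x⌋)) + g (⌊x⌋ + 1) * (x - ⌊x⌋)

lemma interp_eq (g : ℤ → ℝ) (i : ℤ) (s : ℝ) (h0 : 0 ≤ s) (h1 : s ≤ 1) :
    interp g (s + i) = g i * (1 - s) + g (i + 1) * s := by
  rcases h1.lt_or_eq with h | rfl
  · have : ⌊s + (i : ℝ)⌋ = i := by
      rw [Int.floor_add_intCast, Int.floor_eq_zero_iff.2 ⟨h0, h⟩, zero_add]
    unfold interp
    rw [this]; ring_nf
  · have : ⌊1 + (i : ℝ)⌋ = i + 1 := by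
      rw [Int.floor_add_intCast, Int.floor_one, add_comm]
    unfold interp
    rw [this]; push_cast; ring_nf

/-- Bilinear interpolation of the values of `f` on the grid of mesh `L ^ (-n)`. -/
noncomputable def ext (L n : ℕ) (f : ℝ × ℝ → ℝ) (x : ℝ × ℝ) : ℝ :=
  interp (fun i => interp (fun j => f ((i : ℝ) / (L : ℝ) ^ n, (j : ℝ) / (L : ℝ) ^ n))
    (x.2 * (L : ℝ) ^ n)) (x.1 * (L : ℝ) ^ n)

lemma ext_PsiW {L : ℕ} {A : Finset (ℕ × ℕ)} (hL : 3 ≤ L) {n : ℕ} (f : ℝ × ℝ → ℝ)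
    (u : Word A n) (s t : ℝ) (hs0 : 0 ≤ s) (hs1 : s ≤ 1) (ht0 : 0 ≤ t) (ht1 : t ≤ 1) :
    ext L n f (PsiW L u (s, t)) =
      (f (PsiW L u (0, 0)) * (1 - t) + f (PsiW L u (0, 1)) * t) * (1 - s) +
      (f (PsiW L u (1, 0)) * (1 - t) + f (PsiW L u (1, 1)) * t) * s := by
  have hL0 : (L : ℝ) ^ n ≠ 0 := by
    have : L ≠ 0 := by omega
    exact pow_ne_zero _ (by exact_mod_cast this)
  simp only [PsiW_eq L hL, ext, div_mul_cancel₀ _ hL0]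
  have e1 := fun g => interp_eq g ((idx L n u).1 : ℤ) s hs0 hs1
  have e2 := fun g => interp_eq g ((idx L n u).2 : ℤ) t ht0 ht1
  simp only [Int.cast_natCast] at e1 e2
  rw [e1, e2, e2]
  push_cast
  simp only [zero_add, add_comm (1 : ℝ)]

lemma ext_corner (L n : ℕ) (hL : 3 ≤ L) (f : ℝ × ℝ → ℝ) :
    ext L n f (0, 0) = f (0, 0) ∧ ext L n f (1, 0) = f (1, 0) := by
  have hL0 : (L : ℝ) ^ n ≠ 0 := by
    have : L ≠ 0 := by omega
    exact pow_ne_zero _ (by exact_mod_cast this)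
  have e : ∀ (g : ℤ → ℝ) (i : ℤ), interp g (i : ℝ) = g i := by
    intro g i
    have := interp_eq g i 0 le_rfl zero_le_one
    simpa using this
  have e0 : ∀ (g : ℤ → ℝ), interp g 0 = g 0 := fun g => by simpa using e g 0
  have e1 : ∀ (g : ℤ → ℝ), interp g ((L : ℝ) ^ n) = g (L ^ n) := fun g => by
    have := e g ((L : ℤ) ^ n)
    push_cast at this
    exact this
  constructor
  · simp [ext, e0]
  · simp [ext, e0, e1, div_self hL0]

lemma V0_mem {p : ℝ × ℝ} (hp : p ∈ V0) : (p.1 = 0 ∨ p.1 = 1) ∧ (p.2 = 0 ∨ p.2 = 1) := by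
  simp only [V0, Finset.mem_insert, Finset.mem_singleton] at hp
  rcases hp with rfl | rfl | rfl | rfl <;> simp

/-- Energy of `f` on one cell. -/
noncomputable def cellE (L : ℕ) {A : Finset (ℕ × ℕ)} {n : ℕ} (f : ℝ × ℝ → ℝ) (u : Word A n) : ℝ :=
  (f (PsiW L u (0, 0)) - f (PsiW L u (1, 0))) ^ 2 + (f (PsiW L u (0, 1)) - f (PsiW L u (1, 1))) ^ 2
  + (f (PsiW L u (0, 0)) - f (PsiW L u (0, 1))) ^ 2
  + (f (PsiW L u (1, 0)) - f (PsiW L u (1, 1))) ^ 2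

lemma eud {p q : ℝ × ℝ} (e : (p.1 - q.1) ^ 2 + (p.2 - q.2) ^ 2 = 1) : eudist p q = 1 := by
  rw [eudist, e, Real.sqrt_one]

lemma sum_cellE {L : ℕ} {A : Finset (ℕ × ℕ)} (h : GoodCarpet L A) (n : ℕ) (f : ℝ × ℝ → ℝ) :
    ∑ u : Word A n, cellE L f u ≤ 8 * Dform L A n f := by
  simp only [cellE, Finset.sum_add_distrib]
  have m1 : ((0 : ℝ), (0 : ℝ)) ∈ V0 := by simp [V0]
  have m2 : ((1 : ℝ), (0 : ℝ)) ∈ V0 := by simp [V0]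
  have m3 : ((0 : ℝ), (1 : ℝ)) ∈ V0 := by simp [V0]
  have m4 : ((1 : ℝ), (1 : ℝ)) ∈ V0 := by simp [V0]
  have a1 := sum_le_Dform h n f m1 m2 (eud (by norm_num))
  have a2 := sum_le_Dform h n f m3 m4 (eud (by norm_num))
  have a3 := sum_le_Dform h n f m1 m3 (eud (by norm_num))
  have a4 := sum_le_Dform h n f m2 m4 (eud (by norm_num))
  linarith

lemma convex_sq (a b t : ℝ) (h0 : 0 ≤ t) (h1 : t ≤ 1) :
    (a * (1 - t) + b * t) ^ 2 ≤ a ^ 2 + b ^ 2 := by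
  have : (a * (1 - t) + b * t) ^ 2 ≤ a ^ 2 * (1 - t) + b ^ 2 * t := by
    have : a ^ 2 * (1 - t) + b ^ 2 * t - (a * (1 - t) + b * t) ^ 2 = t * (1 - t) * (a - b) ^ 2 := by
      ring
    have h3 : 0 ≤ t * (1 - t) * (a - b) ^ 2 :=
      mul_nonneg (mul_nonneg h0 (by linarith)) (sq_nonneg _)
    linarith
  nlinarith [sq_nonneg a, sq_nonneg b]

lemma edge_bound {L : ℕ} {A : Finset (ℕ × ℕ)} (h : GoodCarpet L A) {n k : ℕ} (f : ℝ × ℝ → ℝ)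
    (u : Word A n) (v : Word A k) {p q : ℝ × ℝ} (hp : p ∈ V0) (hq : q ∈ V0)
    (hpq : eudist p q = 1) :
    (ext L n f (PsiW L u (PsiW L v p)) - ext L n f (PsiW L u (PsiW L v q))) ^ 2
      ≤ (1 / (L : ℝ) ^ 2) ^ k * cellE L f u := by
  have hLpos : 0 < (L : ℝ) := by
    have : 0 < L := by have := h.three_le; omega
    exact_mod_cast this
  have hLk : 0 < (L : ℝ) ^ k := pow_pos hLpos k
  have box : ∀ r ∈ V0, ∃ s t : ℝ, 0 ≤ s ∧ s ≤ 1 ∧ 0 ≤ t ∧ t ≤ 1 ∧ PsiW L v r = (s, t) ∧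
      s = (r.1 + (idx L k v).1) / (L : ℝ) ^ k ∧ t = (r.2 + (idx L k v).2) / (L : ℝ) ^ k := by
    intro r hr
    obtain ⟨i1, i2⟩ := idx_lt h v
    have i1' : ((idx L k v).1 : ℝ) + 1 ≤ (L : ℝ) ^ k := by exact_mod_cast i1
    have i2' : ((idx L k v).2 : ℝ) + 1 ≤ (L : ℝ) ^ k := by exact_mod_cast i2
    have j1 : (0 : ℝ) ≤ (idx L k v).1 := Nat.cast_nonneg _
    have j2 : (0 : ℝ) ≤ (idx L k v).2 := Nat.cast_nonneg _
    obtain ⟨r1, r2⟩ := V0_mem hr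
    have k1 : 0 ≤ r.1 ∧ r.1 ≤ 1 := by rcases r1 with e | e <;> rw [e] <;> norm_num
    have k2 : 0 ≤ r.2 ∧ r.2 ≤ 1 := by rcases r2 with e | e <;> rw [e] <;> norm_num
    refine ⟨_, _, ?_, ?_, ?_, ?_, PsiW_eq L h.three_le v r, rfl, rfl⟩
    · exact div_nonneg (by linarith) hLk.le
    · rw [div_le_one hLk]; linarith
    · exact div_nonneg (by linarith) hLk.le
    · rw [div_le_one hLk]; linarith
  obtain ⟨s, t, hs0, hs1, ht0, ht1, ep, es, et⟩ := box p hp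
  obtain ⟨s', t', hs0', hs1', ht0', ht1', eq, es', et'⟩ := box q hq
  rw [ep, eq, ext_PsiW h.three_le f u s t hs0 hs1 ht0 ht1,
    ext_PsiW h.three_le f u s' t' hs0' hs1' ht0' ht1']
  have hd : (p.1 - q.1) ^ 2 + (p.2 - q.2) ^ 2 = 1 := by
    rw [eudist, Real.sqrt_eq_one] at hpq; exact hpq
  have hrho : (1 / (L : ℝ) ^ 2) ^ k = (1 / (L : ℝ) ^ k) ^ 2 := by
    rw [div_pow, div_pow, one_pow, one_pow, ← pow_mul, ← pow_mul, mul_comm]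
  rw [hrho]
  have es2 : s - s' = (p.1 - q.1) * (1 / (L : ℝ) ^ k) := by rw [es, es']; ring
  have et2 : t - t' = (p.2 - q.2) * (1 / (L : ℝ) ^ k) := by rw [et, et']; ring
  have cases : (p.2 = q.2 ∧ (p.1 - q.1) ^ 2 = 1) ∨ (p.1 = q.1 ∧ (p.2 - q.2) ^ 2 = 1) := by
    obtain ⟨p1, p2⟩ := V0_mem hp
    obtain ⟨q1, q2⟩ := V0_mem hq
    rcases p1 with a | a <;> rcases p2 with b | b <;> rcases q1 with c | c <;>
      rcases q2 with d | d <;> rw [a, b, c, d] at hd ⊢ <;>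
      first | (exfalso; norm_num at hd; done) | norm_num
  unfold cellE
  generalize f (PsiW L u (0, 0)) = f00
  generalize f (PsiW L u (1, 0)) = f10
  generalize f (PsiW L u (0, 1)) = f01
  generalize f (PsiW L u (1, 1)) = f11
  rcases cases with ⟨e, e1⟩ | ⟨e, e1⟩
  · have htt : t = t' := by rw [e] at et2; linarith
    subst htt
    have hc := convex_sq (f00 - f10) (f01 - f11) t ht0 ht1
    have e3 : ((f00 * (1 - t) + f01 * t) * (1 - s) + (f10 * (1 - t) + f11 * t) * s -
        ((f00 * (1 - t) + f01 * t) * (1 - s') + (f10 * (1 - t) + f11 * t) * s')) ^ 2 =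
        (1 / (L : ℝ) ^ k) ^ 2 * ((f00 - f10) * (1 - t) + (f01 - f11) * t) ^ 2 := by
      have : (s - s') ^ 2 = (1 / (L : ℝ) ^ k) ^ 2 := by rw [es2, mul_pow, e1, one_mul]
      rw [← this]; ring
    rw [e3]
    refine mul_le_mul_of_nonneg_left ?_ (sq_nonneg _)
    linarith [sq_nonneg (f00 - f01), sq_nonneg (f10 - f11)]
  · have hss : s = s' := by rw [e] at es2; linarith
    subst hss
    have hc := convex_sq (f00 - f01) (f10 - f11) s hs0 hs1
    have e3 : ((f00 * (1 - t) + f01 * t) * (1 - s) + (f10 * (1 - t) + f11 * t) * s -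
        ((f00 * (1 - t') + f01 * t') * (1 - s) + (f10 * (1 - t') + f11 * t') * s)) ^ 2 =
        (1 / (L : ℝ) ^ k) ^ 2 * ((f00 - f01) * (1 - s) + (f10 - f11) * s) ^ 2 := by
      have : (t - t') ^ 2 = (1 / (L : ℝ) ^ k) ^ 2 := by rw [et2, mul_pow, e1, one_mul]
      rw [← this]; ring
    rw [e3]
    refine mul_le_mul_of_nonneg_left ?_ (sq_nonneg _)
    linarith [sq_nonneg (f00 - f10), sq_nonneg (f01 - f11)]

lemma card_pairs : ((V0 ×ˢ V0).filter (fun r => eudist r.1 r.2 = 1)).card ≤ 16 := by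
  have h4 : V0.card ≤ 4 := Finset.card_le_four
  calc _ ≤ (V0 ×ˢ V0).card := Finset.card_filter_le _ _
    _ = V0.card * V0.card := Finset.card_product _ _
    _ ≤ 4 * 4 := Nat.mul_le_mul h4 h4

lemma ext_energy {L : ℕ} {A : Finset (ℕ × ℕ)} (h : GoodCarpet L A) (n k : ℕ) (f : ℝ × ℝ → ℝ) :
    Dform L A (n + k) (ext L n f) ≤ 64 * ((A.card : ℝ) / (L : ℝ) ^ 2) ^ k * Dform L A n f := by
  have hpos : 0 ≤ (1 / (L : ℝ) ^ 2) ^ k := by positivity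
  have cell0 : ∀ u : Word A n, 0 ≤ cellE L f u := fun u => by unfold cellE; positivity
  have hcard : (Fintype.card (Word A k) : ℝ) = (A.card : ℝ) ^ k := by
    simp [Word]
  calc Dform L A (n + k) (ext L n f)
      ≤ (1 / 2) * ∑ w : Word A (n + k),
      ∑ r ∈ (V0 ×ˢ V0).filter (fun r => eudist r.1 r.2 = 1),
        (ext L n f (PsiW L w r.1) - ext L n f (PsiW L w r.2)) ^ 2 := Dform_le _ _ _ _
    _ = (1 / 2) * ∑ uv : Word A n × Word A k,
      ∑ r ∈ (V0 ×ˢ V0).filter (fun r => eudist r.1 r.2 = 1),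
        (ext L n f (PsiW L uv.1 (PsiW L uv.2 r.1)) -
          ext L n f (PsiW L uv.1 (PsiW L uv.2 r.2))) ^ 2 := by
        congr 1
        symm
        refine Fintype.sum_equiv (Fin.appendEquiv n k) _ _ ?_
        intro uv
        refine Finset.sum_congr rfl fun r _ => ?_
        rw [← PsiW_append, ← PsiW_append]
        rfl
    _ ≤ (1 / 2) * ∑ uv : Word A n × Word A k, 16 * ((1 / (L : ℝ) ^ 2) ^ k * cellE L f uv.1) := by
        refine mul_le_mul_of_nonneg_left ?_ (by norm_num)
        refine Finset.sum_le_sum fun uv _ => ?_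
        refine (Finset.sum_le_card_nsmul _ _ ((1 / (L : ℝ) ^ 2) ^ k * cellE L f uv.1) ?_).trans ?_
        · intro r hr
          obtain ⟨h1, h2⟩ := Finset.mem_filter.1 hr
          obtain ⟨h3, h4⟩ := Finset.mem_product.1 h1
          exact edge_bound h f uv.1 uv.2 h3 h4 h2
        · rw [nsmul_eq_mul]
          refine mul_le_mul_of_nonneg_right ?_ (mul_nonneg hpos (cell0 _))
          exact_mod_cast card_pairs
    _ = 8 * ((A.card : ℝ) / (L : ℝ) ^ 2) ^ k * ∑ u : Word A n, cellE L f u := by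
        rw [Fintype.sum_prod_type]
        simp only [Finset.sum_const, Finset.card_univ, nsmul_eq_mul, hcard]
        rw [← Finset.mul_sum, ← Finset.mul_sum, ← Finset.mul_sum, div_pow, div_pow, one_pow]
        ring
    _ ≤ 8 * ((A.card : ℝ) / (L : ℝ) ^ 2) ^ k * (8 * Dform L A n f) :=
        mul_le_mul_of_nonneg_left (sum_cellE h n f) (by positivity)
    _ = _ := by ring

lemma exists_bottom {L : ℕ} {A : Finset (ℕ × ℕ)} (h : GoodCarpet L A) (n i : ℕ) (hi : i < L ^ n) :
    ∃ w : Word A n, idx L n w = (i, 0) := by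
  induction n generalizing i with
  | zero => exact ⟨Fin.elim0, by simp at hi; simp [idx, hi]⟩
  | succ n ih =>
    have hLp : 0 < L := by have := h.three_le; omega
    have hN : 0 < L ^ n := pow_pos hLp n
    obtain ⟨w, hw⟩ := ih (i % L ^ n) (Nat.mod_lt _ hN)
    have hq : i / L ^ n < L := by
      rw [Nat.div_lt_iff_lt_mul hN]; rw [pow_succ'] at hi; exact hi
    have hm : (i / L ^ n, 0) ∈ A := h.flat_border _ _ hq hLp (by simp)
    refine ⟨Fin.cons ⟨_, hm⟩ w, ?_⟩
    simp only [idx, Fin.cons_zero, Fin.tail_cons, hw]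
    rw [Nat.div_add_mod']
    simp

lemma Dform_nonneg (L : ℕ) (A : Finset (ℕ × ℕ)) (n : ℕ) (f : ℝ × ℝ → ℝ) : 0 ≤ Dform L A n f := by
  rw [Dform_eq]; positivity

lemma Dform_lower {L : ℕ} {A : Finset (ℕ × ℕ)} (h : GoodCarpet L A) (n : ℕ) (f : ℝ × ℝ → ℝ)
    (h0 : f (0, 0) = 1) (h1 : f (1, 0) = 0) :
    1 / (2 * ((L : ℝ) ^ n) ^ 2) ≤ Dform L A n f := by
  have hLpos : 0 < (L : ℝ) := by
    have : 0 < L := by have := h.three_le; omega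
    exact_mod_cast this
  have hLn : 0 < (L : ℝ) ^ n := pow_pos hLpos n
  set S := Real.sqrt (2 * Dform L A n f) with hS
  have hD := Dform_nonneg L A n f
  have m1 : ((0 : ℝ), (0 : ℝ)) ∈ V0 := by simp [V0]
  have m2 : ((1 : ℝ), (0 : ℝ)) ∈ V0 := by simp [V0]
  have a1 := sum_le_Dform h n f m1 m2 (eud (by norm_num))
  have step : ∀ i : ℕ, i < L ^ n →
      f ((i : ℝ) / (L : ℝ) ^ n, 0) - f (((i + 1 : ℕ) : ℝ) / (L : ℝ) ^ n, 0) ≤ S := by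
    intro i hi
    obtain ⟨w, hw⟩ := exists_bottom h n i hi
    have hle := (Finset.single_le_sum
      (f := fun u : Word A n => (f (PsiW L u (0, 0)) - f (PsiW L u (1, 0))) ^ 2)
      (fun _ _ => sq_nonneg _) (Finset.mem_univ w)).trans a1
    simp only [PsiW_eq L h.three_le, hw, Nat.cast_zero, add_zero, zero_add, zero_div] at hle
    have := Real.le_sqrt_of_sq_le hle
    rw [add_comm (1 : ℝ)] at this
    push_cast
    exact this
  have acc : ∀ i : ℕ, i ≤ L ^ n →
      f (0, 0) - f ((i : ℝ) / (L : ℝ) ^ n, 0) ≤ i * S := by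
    intro i
    induction i with
    | zero => intro _; simp
    | succ i ih =>
      intro hi
      have := ih (by omega)
      have := step i (by omega)
      push_cast at *
      linarith
  have fin := acc (L ^ n) le_rfl
  push_cast at fin
  rw [div_self hLn.ne', h0, h1] at fin
  have hSq : S ^ 2 = 2 * Dform L A n f := Real.sq_sqrt (by linarith)
  rw [div_le_iff₀ (by positivity)]
  have : (1 : ℝ) ≤ ((L : ℝ) ^ n * S) ^ 2 := by nlinarith
  rw [mul_pow, hSq] at this
  linarith

lemma card_lt {L : ℕ} {A : Finset (ℕ × ℕ)} (h : GoodCarpet L A) : 0 < A.card ∧ A.card < L ^ 2 := by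
  constructor
  · have := h.three_le
    exact Finset.card_pos.2 ⟨(0, 0), h.flat_border 0 0 (by omega) (by omega) (by simp)⟩
  · obtain ⟨a, b, ha, hb, hab⟩ := h.proper
    have : A ⊂ Finset.range L ×ˢ Finset.range L := by
      refine (Finset.ssubset_iff_of_subset ?_).2 ⟨(a, b), by simp [ha, hb], hab⟩
      intro p hp
      have := h.mem_lt p hp
      simp [this]
    have := Finset.card_lt_card this
    rw [Finset.card_product, Finset.card_range] at this
    rw [pow_two]; exact this

/-- equation (3.14), planar case: reverse doubling estimate for the
resistance sequence. -/
theorem reverse_doubling (L : ℕ) (A : Finset (ℕ × ℕ)) (h : GoodCarpet L A) :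
    ∃ c : ℝ, 1 ≤ c ∧ 1 < (L : ℝ) ^ 2 / A.card ∧
      ∀ n m : ℕ, n ≤ m →
        ((L : ℝ) ^ 2 / A.card) ^ (m - n) * RR L A n ≤ c * RR L A m := by
  obtain ⟨hc0, hc1⟩ := card_lt h
  have hc0' : (0 : ℝ) < A.card := by exact_mod_cast hc0
  have hc1' : (A.card : ℝ) < (L : ℝ) ^ 2 := by exact_mod_cast hc1
  have hLpos : 0 < (L : ℝ) := by
    have : 0 < L := by have := h.three_le; omega
    exact_mod_cast this
  refine ⟨64, by norm_num, (one_lt_div hc0').2 hc1', ?_⟩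
  intro n m hnm
  obtain ⟨k, rfl⟩ := Nat.exists_eq_add_of_le hnm
  rw [Nat.add_sub_cancel_left]
  set E : ℕ → Set ℝ := fun j => {e : ℝ | ∃ f : ℝ × ℝ → ℝ,
      (∀ x ∈ ({((0 : ℝ), (0 : ℝ))} : Set (ℝ × ℝ)), f x = 1) ∧
      (∀ x ∈ ({((1 : ℝ), (0 : ℝ))} : Set (ℝ × ℝ)), f x = 0) ∧ e = Dform L A j f} with hE
  have hne : ∀ j, (E j).Nonempty := by
    intro j
    refine ⟨_, fun x => 1 - x.1, ?_, ?_, rfl⟩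
    · intro x hx; rw [Set.mem_singleton_iff.1 hx]; norm_num
    · intro x hx; rw [Set.mem_singleton_iff.1 hx]; norm_num
  have hlow : ∀ j, ∀ e ∈ E j, 1 / (2 * ((L : ℝ) ^ j) ^ 2) ≤ e := by
    rintro j e ⟨f, h0, h1, rfl⟩
    exact Dform_lower h j f (h0 _ rfl) (h1 _ rfl)
  have hpos : ∀ j, 0 < sInf (E j) := fun j =>
    lt_of_lt_of_le (by positivity) (le_csInf (hne j) (hlow j))
  set ρ : ℝ := (L : ℝ) ^ 2 / A.card with hρ
  have hρ0 : 0 < ρ := by positivity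
  have hinv : (A.card : ℝ) / (L : ℝ) ^ 2 = ρ⁻¹ := by rw [hρ, inv_div]
  have main : ρ ^ k * sInf (E (n + k)) / 64 ≤ sInf (E n) := by
    refine le_csInf (hne n) ?_
    rintro e ⟨f, h0, h1, rfl⟩
    have hmem : Dform L A (n + k) (ext L n f) ∈ E (n + k) := by
      obtain ⟨c0, c1⟩ := ext_corner L n h.three_le f
      refine ⟨_, ?_, ?_, rfl⟩
      · intro x hx; rw [Set.mem_singleton_iff.1 hx, c0]; exact h0 _ rfl
      · intro x hx; rw [Set.mem_singleton_iff.1 hx, c1]; exact h1 _ rfl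
    have h2 : sInf (E (n + k)) ≤ Dform L A (n + k) (ext L n f) :=
      csInf_le ⟨_, hlow (n + k)⟩ hmem
    have h3 := h2.trans (ext_energy h n k f)
    rw [hinv, inv_pow] at h3
    have h4 := mul_le_mul_of_nonneg_left h3 (pow_pos hρ0 k).le
    have h5 : ρ ^ k * (64 * (ρ ^ k)⁻¹ * Dform L A n f) = 64 * Dform L A n f := by
      have := (pow_pos hρ0 k).ne'
      field_simp
    rw [h5] at h4
    linarith
  change ρ ^ k * (sInf (E n))⁻¹ ≤ 64 * (sInf (E (n + k)))⁻¹
  rw [← div_eq_mul_inv, ← div_eq_mul_inv, div_le_div_iff₀ (hpos n) (hpos (n + k))]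
  linarith

end Carpet
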